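/- Fix S ∈ 𝒮* and let 0 ≤ t ≤ s ≤ T. Then: (1) for any D ⊆ L^∞_d(F_s) with D + Γ_s(S_s) ⊆ D and any X ∈ L^∞_d(F): X ∈ D + A_s^π if and only if −π_s^S(X) ∈ S_s^T D; (2) A_{t,s}^φ + A_s^φ = S_T^T [ A_{t,s}^π + A_s^π ], where A_r^φ := { Z ∈ L^∞(F) : φ_r^S(Z) ≤ 0 }, A_{t,s}^φ := A_t^φ ∩ L^∞(F_s), A_r^π := { X ∈ L^∞_d(F) : π_r^S(X) ≤ 0 }, and A_{t,s}^π := A_t^π ∩ L^∞_d(F_s). -/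

import Mathlib

open MeasureTheory Filter Set
open scoped ENNReal

noncomputable section

namespace RiskPaper

variable {Ω : Type*}

/-- Euclidean inner product on `Fin d → ℝ`. -/
def dot {d : ℕ} (x y : Fin d → ℝ) : ℝ := ∑ i, x i * y i

/-- The first unit vector `e₁ = (1,0,…,0) ∈ ℝ^d`. -/
def e1 (d : ℕ) : Fin d → ℝ := fun i => if (i : ℕ) = 0 then 1 else 0

/-- The `i`-th unit vector of `ℝ^d`. -/
def eVec {d : ℕ} (i : Fin d) : Fin d → ℝ := fun j => if j = i then 1 else 0

/-- Measurability with respect to an explicitly given σ-algebra on the domain. -/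
def MeasF {α : Type*} [MeasurableSpace α] (m : MeasurableSpace Ω) (f : Ω → α) : Prop :=
  @Measurable Ω α m _ f

/-- `L^∞_d(F_t)`: bounded `F_t`-measurable `ℝ^d`-valued random variables
(pointwise representatives). -/
def LinfD (F : ℕ → MeasurableSpace Ω) (d t : ℕ) : Set (Ω → Fin d → ℝ) :=
  {X | MeasF (F t) X ∧ ∃ C : ℝ, ∀ ω i, |X ω i| ≤ C}

/-- `L^∞(F_t)`: bounded `F_t`-measurable scalar random variables. -/
def Linf (F : ℕ → MeasurableSpace Ω) (t : ℕ) : Set (Ω → ℝ) :=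
  {x | MeasF (F t) x ∧ ∃ C : ℝ, ∀ ω, |x ω| ≤ C}

/-- The eligible space `M_t = L^∞(F_t) × {0}^{d-1}` (portfolios held in the first asset). -/
def Mt (F : ℕ → MeasurableSpace Ω) (d t : ℕ) : Set (Ω → Fin d → ℝ) :=
  {m | m ∈ LinfD F d t ∧ ∀ ω, ∀ i : Fin d, (i : ℕ) ≠ 0 → m ω i = 0}

/-- The nonnegative elements `M_{t,+}` of `M_t`. -/
def MtPlus (F : ℕ → MeasurableSpace Ω) (d t : ℕ) : Set (Ω → Fin d → ℝ) :=
  {m | m ∈ Mt F d t ∧ ∀ ω i, 0 ≤ m ω i}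

/-- Structural assumptions on the filtration `(F_t)_{t=0}^T`: increasing, contained in the
ambient σ-algebra, `F_T` equal to the ambient σ-algebra, and `F_0` `P`-trivial. -/
def FiltrationOK [m0 : MeasurableSpace Ω] (F : ℕ → MeasurableSpace Ω) (P : Measure Ω)
    (T : ℕ) : Prop :=
  (∀ s t : ℕ, s ≤ t → F s ≤ F t) ∧ (∀ t, F t ≤ m0) ∧ F T = m0 ∧
    ∀ A : Set Ω, MeasurableSet[F 0] A → P A = 0 ∨ P A = 1

section Meas
variable [MeasurableSpace Ω]

/-- `g` is (a version of) the essential infimum of the set `A` of random variables. -/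
def IsEssInfSet (P : Measure Ω) (A : Set (Ω → ℝ)) (g : Ω → ℝ) : Prop :=
  (∀ f ∈ A, ∀ᵐ ω ∂P, g ω ≤ f ω) ∧
    ∀ h : Ω → ℝ, (∀ f ∈ A, ∀ᵐ ω ∂P, h ω ≤ f ω) → ∀ᵐ ω ∂P, h ω ≤ g ω

/-- `g` is (a version of) the essential supremum of the set `A` of random variables. -/
def IsEssSupSet (P : Measure Ω) (A : Set (Ω → ℝ)) (g : Ω → ℝ) : Prop :=
  (∀ f ∈ A, ∀ᵐ ω ∂P, f ω ≤ g ω) ∧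
    ∀ h : Ω → ℝ, (∀ f ∈ A, ∀ᵐ ω ∂P, f ω ≤ h ω) → ∀ᵐ ω ∂P, g ω ≤ h ω

/-- Essential supremum of a set of extended-real-valued random variables
(to accommodate the values `±∞`). -/
def IsEssSupSetE (P : Measure Ω) (A : Set (Ω → EReal)) (g : Ω → EReal) : Prop :=
  (∀ f ∈ A, ∀ᵐ ω ∂P, f ω ≤ g ω) ∧
    ∀ h : Ω → EReal, (∀ f ∈ A, ∀ᵐ ω ∂P, f ω ≤ h ω) → ∀ᵐ ω ∂P, g ω ≤ h ω

/-- Essential infimum of a set of extended-real-valued random variables. -/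
def IsEssInfSetE (P : Measure Ω) (A : Set (Ω → EReal)) (g : Ω → EReal) : Prop :=
  (∀ f ∈ A, ∀ᵐ ω ∂P, g ω ≤ f ω) ∧
    ∀ h : Ω → EReal, (∀ f ∈ A, ∀ᵐ ω ∂P, h ω ≤ f ω) → ∀ᵐ ω ∂P, h ω ≤ g ω

/-- An (extended-real-valued) random variable lies in `L^∞(F_t)`:
it agrees `P`-a.s. with a bounded `F_t`-measurable real random variable. -/
def MemLinfE (F : ℕ → MeasurableSpace Ω) (P : Measure Ω) (t : ℕ) (g : Ω → EReal) : Prop :=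
  ∃ x ∈ Linf F t, g =ᵐ[P] fun ω => (x ω : EReal)

/-- The Radon–Nikodym density `dQ/dP` as a real random variable. -/
def rnd (P Q : Measure Ω) : Ω → ℝ := fun ω => (Q.rnDeriv P ω).toReal

/-- `ξ̄_{t,T}(Q) = (dQ/dP)/E[dQ/dP | F_t]` on `{E[dQ/dP|F_t] > 0}` and `1` elsewhere. -/
def xiBar (F : ℕ → MeasurableSpace Ω) (P Q : Measure Ω) (t : ℕ) : Ω → ℝ := fun ω =>
  if 0 < (P[rnd P Q | F t]) ω then rnd P Q ω / (P[rnd P Q | F t]) ω else 1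

/-- The `P`-a.s. version of the conditional expectation `E^Q[x | F_t]`, defined as
`E[ξ̄_{t,T}(Q) x | F_t]`. -/
def EQcond (F : ℕ → MeasurableSpace Ω) (P Q : Measure Ω) (t : ℕ) (x : Ω → ℝ) : Ω → ℝ :=
  P[fun ω => xiBar F P Q t ω * x ω | F t]

end Meas

/-- The solvency regions are closed convex cones (pointwise in `ω`). -/
def ConesOK {d : ℕ} (K : ℕ → Ω → Set (Fin d → ℝ)) : Prop :=
  ∀ s (ω : Ω), IsClosed (K s ω) ∧ Convex ℝ (K s ω) ∧
    (0 : Fin d → ℝ) ∈ K s ω ∧ ∀ c : ℝ, 0 ≤ c → ∀ x ∈ K s ω, c • x ∈ K s ω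

/-- The trading set `𝕂_t = Σ_{s=t}^T L^∞_d(F_s; K_s)`. -/
def KK (F : ℕ → MeasurableSpace Ω) (d T : ℕ) (K : ℕ → Ω → Set (Fin d → ℝ)) (t : ℕ) :
    Set (Ω → Fin d → ℝ) :=
  {X | ∃ k : ℕ → Ω → Fin d → ℝ,
      (∀ s, t ≤ s → s ≤ T → k s ∈ LinfD F d s ∧ ∀ ω, k s ω ∈ K s ω) ∧
      ∀ ω, X ω = ∑ s ∈ Finset.Icc t T, k s ω}

/-- Assumption 2.2 of the paper: `K_T ⊇ K̄` a.s. for a convex cone `K̄` with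
`int K̄ ⊇ ℝ^d_+ \ {0}`. -/
def FrictionAssumption [MeasurableSpace Ω] (P : Measure Ω) {d : ℕ} (T : ℕ)
    (K : ℕ → Ω → Set (Fin d → ℝ)) : Prop :=
  ∃ Kbar : Set (Fin d → ℝ), Convex ℝ Kbar ∧
    (∀ c : ℝ, 0 ≤ c → ∀ x ∈ Kbar, c • x ∈ Kbar) ∧
    {x : Fin d → ℝ | (∀ i, 0 ≤ x i) ∧ x ≠ 0} ⊆ interior Kbar ∧
    ∀ᵐ ω ∂P, Kbar ⊆ K T ω

/-- The norm `‖x‖_{𝕂_T,0}` for a deterministic portfolio `x ∈ ℝ^d`: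
`inf{c ∈ ℝ : c e₁ − x ∈ 𝕂_T, x + c e₁ ∈ 𝕂_T}`. -/
def normKT0 (F : ℕ → MeasurableSpace Ω) (d T : ℕ) (K : ℕ → Ω → Set (Fin d → ℝ))
    (x : Fin d → ℝ) : ℝ :=
  sInf {c : ℝ | (fun (_ : Ω) i => c * e1 d i - x i) ∈ KK F d T K T ∧
      (fun (_ : Ω) i => x i + c * e1 d i) ∈ KK F d T K T}

/-- The positive dual cone of a set `C ⊆ ℝ^d`. -/
def dualCone {d : ℕ} (C : Set (Fin d → ℝ)) : Set (Fin d → ℝ) := {y | ∀ x ∈ C, 0 ≤ dot x y}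

section MeasP
variable [MeasurableSpace Ω]

/-- The positive dual cone `𝕂_t^+ ⊆ L^1_d` of the trading set `𝕂_t`. -/
def KKplus (F : ℕ → MeasurableSpace Ω) (P : Measure Ω) (d T : ℕ)
    (K : ℕ → Ω → Set (Fin d → ℝ)) (t : ℕ) : Set (Ω → Fin d → ℝ) :=
  {v | (∀ i : Fin d, Integrable (fun ω => v ω i) P) ∧
      ∀ u ∈ KK F d T K t, 0 ≤ ∫ ω, dot (v ω) (u ω) ∂P}

/-- `(Q,S) ∈ 𝒬_t`: `Q ≪ P` a probability measure and `(S_s)_{s=t}^T` a consistent pricing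
process with `S_{s,1} ≡ 1`, the `L^∞` bound `‖S_{s,i}‖_∞ ≤ max{‖e_i‖_{𝕂_T,0},1}`,
`S_s = E^Q[S_T | F_s]` and `(dQ/dP) S_T ∈ 𝕂_t^+`. -/
def memQt (F : ℕ → MeasurableSpace Ω) (P : Measure Ω) (d T : ℕ)
    (K : ℕ → Ω → Set (Fin d → ℝ)) (t : ℕ) (Q : Measure Ω) (S : ℕ → Ω → Fin d → ℝ) : Prop :=
  IsProbabilityMeasure Q ∧ Q ≪ P ∧
    (∀ s, t ≤ s → s ≤ T →
      S s ∈ LinfD F d s ∧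
      (∀ ω, ∀ i : Fin d, (i : ℕ) = 0 → S s ω i = 1) ∧
      (∀ i : Fin d, ∀ ω, |S s ω i| ≤ max (normKT0 F d T K (eVec i)) 1) ∧
      ∀ i : Fin d, (fun ω => S s ω i) =ᵐ[P] EQcond F P Q s fun ω => S T ω i) ∧
    (fun ω i => rnd P Q ω * S T ω i) ∈ KKplus F P d T K t

/-- `(Q,S) ∈ 𝒬_t^e`: additionally `Q` is equivalent to `P`. -/
def memQtE (F : ℕ → MeasurableSpace Ω) (P : Measure Ω) (d T : ℕ)
    (K : ℕ → Ω → Set (Fin d → ℝ)) (t : ℕ) (Q : Measure Ω) (S : ℕ → Ω → Fin d → ℝ) : Prop :=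
  memQt F P d T K t Q S ∧ P ≪ Q

/-- The set `𝒮` of eligible (frictionless) pricing processes. -/
def memS (F : ℕ → MeasurableSpace Ω) (d T : ℕ) (K : ℕ → Ω → Set (Fin d → ℝ))
    (S : ℕ → Ω → Fin d → ℝ) : Prop :=
  ∀ t ≤ T, S t ∈ LinfD F d t ∧ (∀ ω, S t ω ∈ dualCone (K t ω)) ∧
    (∀ ω, ∀ i : Fin d, (i : ℕ) = 0 → S t ω i = 1) ∧
    ∀ i : Fin d, ∀ ω, |S t ω i| ≤ max (normKT0 F d T K (eVec i)) 1

/-- `Q ∈ 𝒬^e(S)`: `Q` is a probability measure equivalent to `P` under which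
`S` is a martingale (with the `P`-a.s. version of conditional expectations). -/
def QeS (F : ℕ → MeasurableSpace Ω) (P : Measure Ω) (d T : ℕ)
    (S : ℕ → Ω → Fin d → ℝ) : Set (Measure Ω) :=
  {Q | IsProbabilityMeasure Q ∧ Q ≪ P ∧ P ≪ Q ∧
    ∀ s ≤ T, ∀ i : Fin d, (fun ω => S s ω i) =ᵐ[P] EQcond F P Q s fun ω => S T ω i}

/-- The cone `Γ_t(S_t) = {Z ∈ L^∞_d(F_t) : S_t^⊤ Z ≥ 0 a.s.}`. -/
def Gamma (F : ℕ → MeasurableSpace Ω) (P : Measure Ω) (d : ℕ)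
    (S : ℕ → Ω → Fin d → ℝ) (t : ℕ) : Set (Ω → Fin d → ℝ) :=
  {Z | Z ∈ LinfD F d t ∧ ∀ᵐ ω ∂P, 0 ≤ dot (S t ω) (Z ω)}

/-- The set `Σ_{s=0}^T Γ_s(S_s)` of claims attainable from zero. -/
def SumGamma (F : ℕ → MeasurableSpace Ω) (P : Measure Ω) (d T : ℕ)
    (S : ℕ → Ω → Fin d → ℝ) : Set (Ω → Fin d → ℝ) :=
  {X | ∃ Z : ℕ → Ω → Fin d → ℝ, (∀ s ≤ T, Z s ∈ Gamma F P d S s) ∧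
      ∀ ω, X ω = ∑ s ∈ Finset.range (T + 1), Z s ω}

/-- The no-arbitrage condition (NA):
`[Σ_{s=0}^T Γ_s(S_s)] ∩ [−Γ_T(S_T)] ⊆ Γ_T(S_T)`. -/
def NoArb (F : ℕ → MeasurableSpace Ω) (P : Measure Ω) (d T : ℕ)
    (S : ℕ → Ω → Fin d → ℝ) : Prop :=
  ∀ X ∈ SumGamma F P d T S, (fun ω => -X ω) ∈ Gamma F P d S T → X ∈ Gamma F P d S T

/-- `ρ_t` is a scalarized conditional convex risk measure: finite (`L^∞(F_t)`-valued),
conditionally cash invariant in the first asset, monotone, conditionally convex. -/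
structure ScalarRM (F : ℕ → MeasurableSpace Ω) (P : Measure Ω) (d T t : ℕ)
    (rho : (Ω → Fin d → ℝ) → Ω → ℝ) : Prop where
  finite : ∀ X ∈ LinfD F d T, ∃ g ∈ Linf F t, rho X =ᵐ[P] g
  cash : ∀ X ∈ LinfD F d T, ∀ m ∈ Linf F t,
    rho (fun ω => X ω + m ω • e1 d) =ᵐ[P] fun ω => rho X ω - m ω
  mono : ∀ X ∈ LinfD F d T, ∀ Y ∈ LinfD F d T,
    (∀ ω i, X ω i ≤ Y ω i) → rho Y ≤ᵐ[P] rho X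
  convex : ∀ X ∈ LinfD F d T, ∀ Y ∈ LinfD F d T, ∀ lam ∈ Linf F t,
    (∀ ω, lam ω ∈ Set.Icc (0 : ℝ) 1) →
    rho (fun ω => lam ω • X ω + (1 - lam ω) • Y ω) ≤ᵐ[P]
      fun ω => lam ω * rho X ω + (1 - lam ω) * rho Y ω

/-- Conditional positive homogeneity (coherence). -/
def CoherentRM (F : ℕ → MeasurableSpace Ω) (P : Measure Ω) (d T t : ℕ)
    (rho : (Ω → Fin d → ℝ) → Ω → ℝ) : Prop :=
  ∀ X ∈ LinfD F d T, ∀ lam ∈ Linf F t, (∀ ω, 0 ≤ lam ω) →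
    rho (fun ω => lam ω • X ω) =ᵐ[P] fun ω => lam ω * rho X ω

/-- `𝕂_t`-compatibility of a scalar risk measure:
`ρ_t(X) = essinf_{k ∈ 𝕂_t} ρ_t(X−k)`. -/
def KCompat (F : ℕ → MeasurableSpace Ω) (P : Measure Ω) (d T : ℕ)
    (K : ℕ → Ω → Set (Fin d → ℝ)) (t : ℕ) (rho : (Ω → Fin d → ℝ) → Ω → ℝ) : Prop :=
  ∀ X ∈ LinfD F d T,
    IsEssInfSet P {g | ∃ k ∈ KK F d T K t, g = rho fun ω => X ω - k ω} (rho X)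

/-- The acceptance set `A_t = {X ∈ L^∞_d(F) : ρ_t(X) ≤ 0}`. -/
def Acc (F : ℕ → MeasurableSpace Ω) (P : Measure Ω) (d T : ℕ)
    (rho : (Ω → Fin d → ℝ) → Ω → ℝ) : Set (Ω → Fin d → ℝ) :=
  {X | X ∈ LinfD F d T ∧ ∀ᵐ ω ∂P, rho X ω ≤ 0}

/-- `β` is (a version of) the penalty function
`β_t(Q,S) = esssup_{Z ∈ A} −E^Q[S_T^⊤ Z | F_t]`. -/
def IsPenalty (F : ℕ → MeasurableSpace Ω) (P : Measure Ω) (d T t : ℕ)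
    (A : Set (Ω → Fin d → ℝ)) (Q : Measure Ω) (S : ℕ → Ω → Fin d → ℝ)
    (beta : Ω → EReal) : Prop :=
  IsEssSupSetE P
    {g | ∃ Z ∈ A, g = fun ω =>
      ((-(EQcond F P Q t (fun ω' => dot (S T ω') (Z ω')) ω) : ℝ) : EReal)} beta

/-- `g` is (a version of) `π_t^S(X) = esssup_{Q ∈ 𝒬^e(S)} (−β_t(Q,S) − E^Q[S_T^⊤ X|F_t])`. -/
def IsPi (F : ℕ → MeasurableSpace Ω) (P : Measure Ω) (d T t : ℕ)
    (beta : Measure Ω → Ω → EReal) (S : ℕ → Ω → Fin d → ℝ) (X : Ω → Fin d → ℝ)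
    (g : Ω → EReal) : Prop :=
  IsEssSupSetE P
    {h | ∃ Q ∈ QeS F P d T S, h = fun ω =>
      -beta Q ω - ((EQcond F P Q t (fun ω' => dot (S T ω') (X ω')) ω : ℝ) : EReal)} g

/-- The Fatou property of `ρ_t`. -/
def Fatou (F : ℕ → MeasurableSpace Ω) (P : Measure Ω) (d T : ℕ)
    (rho : (Ω → Fin d → ℝ) → Ω → ℝ) : Prop :=
  ∀ X ∈ LinfD F d T, ∀ Xn : ℕ → Ω → Fin d → ℝ, (∀ n, Xn n ∈ LinfD F d T) →
    (∃ C : ℝ, ∀ n ω i, |Xn n ω i| ≤ C) →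
    (∀ᵐ ω ∂P, Tendsto (fun n => Xn n ω) atTop (nhds (X ω))) →
    ∀ᵐ ω ∂P, rho X ω ≤ atTop.liminf fun n => rho (Xn n) ω

/-- Relevance (sensitivity): `P(ρ_t(−ε 1_D e₁) > ρ_t(0)) > 0` for all `ε > 0` and all
`D ∈ F` with positive probability. -/
def Relevant (P : Measure Ω) (d : ℕ) (rho : (Ω → Fin d → ℝ) → Ω → ℝ) : Prop :=
  ∀ ε : ℝ, 0 < ε → ∀ D : Set Ω, MeasurableSet D → 0 < P D →
    0 < P {ω | rho (fun _ _ => 0) ω <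
      rho (fun ω' => (-(ε * D.indicator (fun _ => (1 : ℝ)) ω')) • e1 d) ω}

end MeasP
/-- The acceptance set `A_r^π = {X ∈ L^∞_d(F) : π_r^S(X) ≤ 0}`. -/
def Api [MeasurableSpace Ω] (F : ℕ → MeasurableSpace Ω) (P : Measure Ω) (d T : ℕ)
    (pi : ℕ → (Ω → Fin d → ℝ) → Ω → EReal) (r : ℕ) : Set (Ω → Fin d → ℝ) :=
  {X | X ∈ LinfD F d T ∧ ∀ᵐ ω ∂P, pi r X ω ≤ 0}

/-- The acceptance set `A_r^φ = {Z ∈ L^∞(F) : φ_r^S(Z) ≤ 0}` of `φ_r^S(Z) = π_r^S(Z e₁)`. -/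
def Aphi [MeasurableSpace Ω] (F : ℕ → MeasurableSpace Ω) (P : Measure Ω) (d T : ℕ)
    (pi : ℕ → (Ω → Fin d → ℝ) → Ω → EReal) (r : ℕ) : Set (Ω → ℝ) :=
  {Z | Z ∈ Linf F T ∧ ∀ᵐ ω ∂P, pi r (fun ω' => Z ω' • e1 d) ω ≤ 0}

section LinfAlgebra

variable {F : ℕ → MeasurableSpace Ω} {d r s : ℕ}

theorem Linf_mono (h : F r ≤ F s) {x : Ω → ℝ} (hx : x ∈ Linf F r) : x ∈ Linf F s :=
  ⟨hx.1.mono h le_rfl, hx.2⟩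

theorem LinfD_mono (h : F r ≤ F s) {X : Ω → Fin d → ℝ} (hX : X ∈ LinfD F d r) :
    X ∈ LinfD F d s :=
  ⟨hX.1.mono h le_rfl, hX.2⟩

theorem LinfD_apply {X : Ω → Fin d → ℝ} (hX : X ∈ LinfD F d r) (i : Fin d) :
    (fun ω => X ω i) ∈ Linf F r :=
  ⟨(measurable_pi_apply i).comp hX.1, hX.2.imp fun _ hC ω => hC ω i⟩

theorem Linf_const (c : ℝ) : (fun _ : Ω => c) ∈ Linf F r :=
  ⟨@measurable_const _ _ _ (F r) _, |c|, fun _ => le_rfl⟩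

theorem Linf_add {x y : Ω → ℝ} (hx : x ∈ Linf F r) (hy : y ∈ Linf F r) :
    (fun ω => x ω + y ω) ∈ Linf F r := by
  obtain ⟨hx, C, hC⟩ := hx
  obtain ⟨hy, D, hD⟩ := hy
  exact ⟨Measurable.add hx hy, C + D,
    fun ω => (abs_add_le _ _).trans (add_le_add (hC ω) (hD ω))⟩

theorem Linf_neg {x : Ω → ℝ} (hx : x ∈ Linf F r) : (fun ω => -x ω) ∈ Linf F r := by
  obtain ⟨hx, C, hC⟩ := hx
  exact ⟨Measurable.neg hx, C, fun ω => by rw [abs_neg]; exact hC ω⟩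

theorem Linf_mul {x y : Ω → ℝ} (hx : x ∈ Linf F r) (hy : y ∈ Linf F r) :
    (fun ω => x ω * y ω) ∈ Linf F r := by
  obtain ⟨hx, C, hC⟩ := hx
  obtain ⟨hy, D, hD⟩ := hy
  refine ⟨Measurable.mul hx hy, C * D, fun ω => ?_⟩
  rw [abs_mul]
  exact mul_le_mul (hC ω) (hD ω) (abs_nonneg _) ((abs_nonneg _).trans (hC ω))

theorem Linf_sum {ι : Type*} (I : Finset ι) {x : ι → Ω → ℝ} (hx : ∀ i, x i ∈ Linf F r) :
    (fun ω => ∑ i ∈ I, x i ω) ∈ Linf F r := by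
  classical
  induction I using Finset.induction_on with
  | empty => simpa using Linf_const 0
  | insert a I ha ih =>
    simp only [Finset.sum_insert ha]
    exact Linf_add (hx a) ih

theorem LinfD_of_apply {X : Ω → Fin d → ℝ} (hX : ∀ i, (fun ω => X ω i) ∈ Linf F r) :
    X ∈ LinfD F d r := by
  choose hm C hC using hX
  refine ⟨@measurable_pi_lambda _ _ _ (F r) _ _ hm, ∑ i, |C i|, fun ω i => (hC i ω).trans ?_⟩
  exact (le_abs_self _).trans
    (Finset.single_le_sum (f := fun i => |C i|) (fun j _ => abs_nonneg _) (Finset.mem_univ i))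

theorem LinfD_add {X Y : Ω → Fin d → ℝ} (hX : X ∈ LinfD F d r) (hY : Y ∈ LinfD F d r) :
    (fun ω => X ω + Y ω) ∈ LinfD F d r :=
  LinfD_of_apply fun i => Linf_add (LinfD_apply hX i) (LinfD_apply hY i)

theorem LinfD_sub {X Y : Ω → Fin d → ℝ} (hX : X ∈ LinfD F d r) (hY : Y ∈ LinfD F d r) :
    (fun ω => X ω - Y ω) ∈ LinfD F d r :=
  LinfD_of_apply fun i => by
    simpa [sub_eq_add_neg] using Linf_add (LinfD_apply hX i) (Linf_neg (LinfD_apply hY i))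

theorem LinfD_smul_e1 {x : Ω → ℝ} (hx : x ∈ Linf F r) : (fun ω => x ω • e1 d) ∈ LinfD F d r :=
  LinfD_of_apply fun i => Linf_mul hx (Linf_const (e1 d i))

theorem LinfD_dot {X Y : Ω → Fin d → ℝ} (hX : X ∈ LinfD F d r) (hY : Y ∈ LinfD F d r) :
    (fun ω => dot (X ω) (Y ω)) ∈ Linf F r :=
  Linf_sum _ fun i => Linf_mul (LinfD_apply hX i) (LinfD_apply hY i)

end LinfAlgebra

theorem dot_add {d : ℕ} (x y z : Fin d → ℝ) : dot x (y + z) = dot x y + dot x z := by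
  simp [dot, mul_add, Finset.sum_add_distrib]

theorem dot_sub {d : ℕ} (x y z : Fin d → ℝ) : dot x (y - z) = dot x y - dot x z := by
  simp [dot, mul_sub, Finset.sum_sub_distrib]

theorem dot_smul_e1 {d : ℕ} (hd : 0 < d) {x : Fin d → ℝ} (hx : ∀ i : Fin d, (i : ℕ) = 0 → x i = 1)
    (c : ℝ) : dot x (c • e1 d) = c := by
  unfold dot
  rw [Finset.sum_eq_single ⟨0, hd⟩]
  · simp [e1, hx]
  · intro i _ hi
    have : (i : ℕ) ≠ 0 := fun h => hi (Fin.ext h)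
    simp [e1, this]
  · simp

/-- The essential supremum of a family of `m`-measurable random variables has an `m`-measurable
version. -/
theorem IsEssSupSetE.exists_measurable {m : MeasurableSpace Ω} [m0 : MeasurableSpace Ω]
    {P : Measure Ω} [IsFiniteMeasure P] (hm : m ≤ m0)
    {A : Set (Ω → EReal)} {g : Ω → EReal} (hg : IsEssSupSetE P A g)
    (hA : ∀ f ∈ A, ∃ f', Measurable[m] f' ∧ f =ᵐ[P] f') :
    ∃ g', Measurable[m] g' ∧ g =ᵐ[P] g' := by
  let φ : EReal → ℝ≥0∞ := fun x =>
    (ENNReal.orderIsoIicOneBirational (EReal.expOrderIso x) : ℝ≥0∞)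
  have hφ : StrictMono φ := fun a b hab =>
    (ENNReal.orderIsoIicOneBirational.strictMono (EReal.expOrderIso.strictMono hab) :)
  have hφ1 : ∀ x, φ x ≤ 1 := fun x =>
    (ENNReal.orderIsoIicOneBirational (EReal.expOrderIso x)).2
  let B : Set (Ω → EReal) := {f' | Measurable[m] f' ∧ ∃ f ∈ A, f =ᵐ[P] f'}
  let sp : Set (Ω → EReal) → Ω → EReal := fun C ω => ⨆ f ∈ C, f ω
  let I : Set (Ω → EReal) → ℝ≥0∞ := fun C => ∫⁻ ω, φ (sp C ω) ∂P
  have hsp : ∀ C : Set (Ω → EReal), C.Countable → C ⊆ B → Measurable[m] (sp C) :=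
    fun C hC hCB => Measurable.biSup C hC fun f hf => (hCB hf).1
  have hmono : ∀ {C D : Set (Ω → EReal)}, C ⊆ D → ∀ ω, sp C ω ≤ sp D ω :=
    fun h ω => biSup_mono fun f hf => h hf
  have hImono : ∀ {C D : Set (Ω → EReal)}, C ⊆ D → I C ≤ I D :=
    fun h => lintegral_mono fun ω => hφ.monotone (hmono h ω)
  let V : Set ℝ≥0∞ := I '' {C | C.Countable ∧ C ⊆ B}
  have hV : V.Nonempty := ⟨_, ∅, ⟨countable_empty, empty_subset _⟩, rfl⟩
  obtain ⟨u, -, hu, huV⟩ := exists_seq_tendsto_sSup hV (OrderTop.bddAbove V)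
  choose C hC hCu using huV
  let E := ⋃ n, C n
  have hE : E.Countable ∧ E ⊆ B :=
    ⟨countable_iUnion fun n => (hC n).1, iUnion_subset fun n => (hC n).2⟩
  have hmax : sSup V ≤ I E :=
    le_of_tendsto' hu fun n => by rw [← hCu n]; exact hImono (subset_iUnion C n)
  refine ⟨sp E, hsp E hE.1 hE.2, ?_⟩
  have hup : ∀ f ∈ A, f ≤ᵐ[P] sp E := by
    intro f hf
    obtain ⟨f', hf'm, hff'⟩ := hA f hf
    let D := insert f' E
    have hD : D.Countable ∧ D ⊆ B :=
      ⟨hE.1.insert f', insert_subset ⟨hf'm, f, hf, hff'⟩ hE.2⟩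
    have hle : I D ≤ I E := (le_sSup (show I D ∈ V from ⟨D, hD, rfl⟩)).trans hmax
    have hfin : I E ≠ ∞ := by
      refine ne_top_of_le_ne_top (measure_ne_top P univ) ?_
      calc I E ≤ ∫⁻ _, 1 ∂P := lintegral_mono fun ω => hφ1 _
        _ = P univ := by simp
    have hmeas : Measurable fun ω => φ (sp D ω) :=
      hφ.monotone.measurable.comp ((hsp D hD.1 hD.2).mono hm le_rfl)
    have heq := ae_eq_of_ae_le_of_lintegral_le
      (ae_of_all P fun ω => hφ.monotone (hmono (subset_insert f' E) ω)) hfin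
      hmeas.aemeasurable hle
    filter_upwards [heq, hff'] with ω h1 h2
    rw [h2, hφ.injective h1]
    exact le_biSup (fun f : Ω → EReal => f ω) (mem_insert f' E)
  have hlow : sp E ≤ᵐ[P] g := by
    have : ∀ᵐ ω ∂P, ∀ f ∈ E, f ω ≤ g ω := by
      rw [ae_ball_iff hE.1]
      intro f' hf'
      obtain ⟨-, f, hf, hff'⟩ := hE.2 hf'
      filter_upwards [hg.1 f hf, hff'] with ω h1 h2
      rwa [← h2]
    filter_upwards [this] with ω h
    exact iSup₂_le h
  exact Filter.EventuallyLE.antisymm (hg.2 _ hup) hlow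

section Conditional

variable [m0 : MeasurableSpace Ω] {F : ℕ → MeasurableSpace Ω} {P : Measure Ω}
  {d T : ℕ} {S : ℕ → Ω → Fin d → ℝ} {Q : Measure Ω} {r : ℕ}

theorem integrable_mul_Linf {g x : Ω → ℝ} (hg : Integrable g P) (hr : F r ≤ m0)
    (hx : x ∈ Linf F r) : Integrable (fun ω => g ω * x ω) P := by
  obtain ⟨hx, C, hC⟩ := hx
  exact hg.mul_bdd (c := C) (hx.mono hr le_rfl).aestronglyMeasurable (ae_of_all _ hC)

theorem xiBar_nonneg (ω : Ω) : 0 ≤ xiBar F P Q r ω := by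
  unfold xiBar
  split_ifs with h
  · exact div_nonneg ENNReal.toReal_nonneg h.le
  · exact zero_le_one

theorem condExp_xiBar (hd : 0 < d) (hT : r ≤ T) (hr1 : ∀ ω, ∀ i : Fin d, (i : ℕ) = 0 → S r ω i = 1)
    (hT1 : ∀ ω, ∀ i : Fin d, (i : ℕ) = 0 → S T ω i = 1) (hQ : Q ∈ QeS F P d T S) :
    P[xiBar F P Q r | F r] =ᵐ[P] fun _ => 1 := by
  have h := hQ.2.2.2 r hT ⟨0, hd⟩
  unfold EQcond at h
  simp only [hr1 _ ⟨0, hd⟩ rfl, hT1 _ ⟨0, hd⟩ rfl, mul_one] at h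
  exact h.symm

theorem integrable_of_condExp_eq_one [IsProbabilityMeasure P] {m : MeasurableSpace Ω} {x : Ω → ℝ}
    (h : P[x | m] =ᵐ[P] fun _ => 1) : Integrable x P := by
  by_contra hx
  rw [condExp_of_not_integrable hx] at h
  obtain ⟨ω, hω⟩ := h.exists
  exact zero_ne_one hω

theorem EQcond_congr {x y : Ω → ℝ} (h : x =ᵐ[P] y) : EQcond F P Q r x =ᵐ[P] EQcond F P Q r y :=
  condExp_congr_ae (h.mono fun ω hω => by simp only [hω])

theorem EQcond_add [IsProbabilityMeasure P] (hT : F T ≤ m0) (hξ : Integrable (xiBar F P Q r) P)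
    {x y : Ω → ℝ} (hx : x ∈ Linf F T) (hy : y ∈ Linf F T) :
    EQcond F P Q r (fun ω => x ω + y ω) =ᵐ[P]
      fun ω => EQcond F P Q r x ω + EQcond F P Q r y ω := by
  unfold EQcond
  simp only [mul_add]
  exact condExp_add (integrable_mul_Linf hξ hT hx) (integrable_mul_Linf hξ hT hy) _

theorem EQcond_mono [IsProbabilityMeasure P] (hT : F T ≤ m0) (hξ : Integrable (xiBar F P Q r) P)
    {x y : Ω → ℝ} (hx : x ∈ Linf F T) (hy : y ∈ Linf F T) (hxy : ∀ ω, x ω ≤ y ω) :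
    EQcond F P Q r x ≤ᵐ[P] EQcond F P Q r y :=
  condExp_mono (integrable_mul_Linf hξ hT hx) (integrable_mul_Linf hξ hT hy)
    (ae_of_all _ fun ω => mul_le_mul_of_nonneg_left (hxy ω) (xiBar_nonneg ω))

theorem EQcond_of_measurable [IsProbabilityMeasure P] (hr : F r ≤ m0) (h1 : P[xiBar F P Q r | F r] =ᵐ[P] fun _ => 1)
    {x : Ω → ℝ} (hx : x ∈ Linf F r) : EQcond F P Q r x =ᵐ[P] x := by
  have hξ := integrable_of_condExp_eq_one h1
  have := condExp_mul_of_stronglyMeasurable_right (m := F r) (f := xiBar F P Q r)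
    (Measurable.stronglyMeasurable hx.1) (integrable_mul_Linf hξ hr hx) hξ
  filter_upwards [this, h1] with ω h2 h3
  change (P[xiBar F P Q r * x | F r]) ω = x ω
  rw [h2, Pi.mul_apply, h3, one_mul]

/-- Under a martingale measure for `S`, the conditional value of an `F_r`-measurable portfolio
is its value at the prices `S_r`. -/
theorem EQcond_dot [IsProbabilityMeasure P] (hr : F r ≤ m0) (hT : F T ≤ m0) (hrT : r ≤ T)
    (hξ : Integrable (xiBar F P Q r) P) (hQ : Q ∈ QeS F P d T S) (hS : S T ∈ LinfD F d T)
    {u : Ω → Fin d → ℝ} (hu : u ∈ LinfD F d r) :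
    EQcond F P Q r (fun ω => dot (S T ω) (u ω)) =ᵐ[P] fun ω => dot (S r ω) (u ω) := by
  have hξS : ∀ i, Integrable (fun ω => xiBar F P Q r ω * S T ω i) P :=
    fun i => integrable_mul_Linf hξ hT (LinfD_apply hS i)
  have hξSu : ∀ i, Integrable (fun ω => xiBar F P Q r ω * S T ω i * u ω i) P :=
    fun i => integrable_mul_Linf (hξS i) hr (LinfD_apply hu i)
  have hpull : ∀ i, P[fun ω => xiBar F P Q r ω * S T ω i * u ω i | F r] =ᵐ[P]
      fun ω => S r ω i * u ω i := by
    intro i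
    have := condExp_mul_of_stronglyMeasurable_right (m := F r)
      (f := fun ω => xiBar F P Q r ω * S T ω i)
      (Measurable.stronglyMeasurable (LinfD_apply hu i).1) (hξSu i) (hξS i)
    filter_upwards [this, hQ.2.2.2 r hrT i] with ω h2 h3
    rw [h3]
    exact h2
  have hfun : (fun ω => xiBar F P Q r ω * dot (S T ω) (u ω)) =
      ∑ i, fun ω => xiBar F P Q r ω * S T ω i * u ω i := by
    ext ω
    simp [dot, Finset.mul_sum, mul_assoc]
  unfold EQcond
  rw [hfun]
  filter_upwards [condExp_finsetSum (fun i (_ : i ∈ Finset.univ) => hξSu i) (F r),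
    ae_all_iff.2 hpull] with ω h1 h2
  rw [h1, Finset.sum_apply]
  exact Finset.sum_congr rfl fun i _ => h2 i

theorem condExp_rnd_pos [IsProbabilityMeasure P] (hr : F r ≤ m0) (hQ : Q ∈ QeS F P d T S) :
    ∀ᵐ ω ∂P, 0 < (P[rnd P Q | F r]) ω := by
  obtain ⟨_, hQP, hPQ, -⟩ := hQ
  have hint : Integrable (rnd P Q) P := Measure.integrable_toReal_rnDeriv
  have hpos : ∀ᵐ ω ∂P, 0 < rnd P Q ω := by
    filter_upwards [Measure.rnDeriv_pos' hPQ, Measure.rnDeriv_lt_top Q P] with ω h1 h2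
    exact ENNReal.toReal_pos h1.ne' h2.ne
  have hmeas : Measurable[F r] (P[rnd P Q | F r]) := stronglyMeasurable_condExp.measurable
  let N : Set Ω := {ω | (P[rnd P Q | F r]) ω ≤ 0}
  have hN : MeasurableSet[F r] N := measurableSet_le hmeas measurable_const
  have h1 : ∫ ω in N, rnd P Q ω ∂P ≤ 0 := by
    rw [← setIntegral_condExp hr hint hN]
    exact setIntegral_nonpos (hr _ hN) fun ω hω => hω
  have h2 : P N = 0 := by
    by_contra hne
    have : 0 < ∫ ω in N, rnd P Q ω ∂P := by
      rw [setIntegral_pos_iff_support_of_nonneg_ae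
        (ae_restrict_of_ae (hpos.mono fun ω h => h.le)) hint.integrableOn]
      have hsupp : (Function.support (rnd P Q) ∩ N : Set Ω) =ᵐ[P] N := by
        filter_upwards [hpos] with ω hω
        exact propext ⟨fun h => h.2, fun h => ⟨hω.ne', h⟩⟩
      rw [measure_congr hsupp]
      exact pos_iff_ne_zero.2 hne
    exact absurd h1 (not_le.2 this)
  filter_upwards [measure_eq_zero_iff_ae_notMem.1 h2] with ω hω
  exact not_le.1 hω

/-- The tower property of `E^Q[· | F_r]`. -/
theorem EQcond_tower [IsProbabilityMeasure P] {t s : ℕ} (hts : F t ≤ F s) (hs : F s ≤ m0) (hT : F T ≤ m0)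
    (hξt : Integrable (xiBar F P Q t) P)
    (h1 : P[xiBar F P Q s | F s] =ᵐ[P] fun _ => 1)
    (hQ : Q ∈ QeS F P d T S) {x y : Ω → ℝ} (hx : x ∈ Linf F T) (hy : y ∈ Linf F s)
    (hxy : EQcond F P Q s x =ᵐ[P] y) :
    EQcond F P Q t y =ᵐ[P] EQcond F P Q t x := by
  have hξs := integrable_of_condExp_eq_one h1
  let w : Ω → ℝ := fun ω => (P[rnd P Q | F s]) ω / (P[rnd P Q | F t]) ω
  have hw : StronglyMeasurable[F s] w := by
    have h2 : Measurable[F s] (P[rnd P Q | F s]) := stronglyMeasurable_condExp.measurable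
    have h3 : Measurable[F s] (P[rnd P Q | F t]) :=
      stronglyMeasurable_condExp.measurable.mono hts le_rfl
    exact (h2.div h3).stronglyMeasurable
  have hξ : xiBar F P Q t =ᵐ[P] fun ω => w ω * xiBar F P Q s ω := by
    filter_upwards [condExp_rnd_pos (hts.trans hs) hQ, condExp_rnd_pos hs hQ] with ω ht hs
    simp only [xiBar, if_pos ht, if_pos hs, w]
    field_simp
  have key : ∀ z ∈ Linf F T,
      P[fun ω => xiBar F P Q t ω * z ω | F s] =ᵐ[P] fun ω => w ω * EQcond F P Q s z ω := by
    intro z hz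
    have hz' : (fun ω => xiBar F P Q t ω * z ω) =ᵐ[P]
        w * fun ω => xiBar F P Q s ω * z ω := by
      filter_upwards [hξ] with ω hω
      simp only [hω, Pi.mul_apply, mul_assoc]
    refine (condExp_congr_ae hz').trans ?_
    exact condExp_mul_of_stronglyMeasurable_left hw
      ((integrable_mul_Linf hξt hT hz).congr hz') (integrable_mul_Linf hξs hT hz)
  have hys : P[fun ω => xiBar F P Q t ω * y ω | F s] =ᵐ[P] fun ω => w ω * y ω := by
    have hz' : (fun ω => xiBar F P Q t ω * y ω) =ᵐ[P]
        w * fun ω => xiBar F P Q s ω * y ω := by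
      filter_upwards [hξ] with ω hω
      simp only [hω, Pi.mul_apply, mul_assoc]
    refine (condExp_congr_ae hz').trans ?_
    refine (condExp_mul_of_stronglyMeasurable_left hw
      ((integrable_mul_Linf hξt hs hy).congr hz') (integrable_mul_Linf hξs hs hy)).trans ?_
    filter_upwards [EQcond_of_measurable hs h1 hy] with ω hω
    rw [Pi.mul_apply]
    exact congrArg _ hω
  have hsame : P[fun ω => xiBar F P Q t ω * y ω | F s] =ᵐ[P]
      P[fun ω => xiBar F P Q t ω * x ω | F s] := by
    filter_upwards [hys, key x hx, hxy] with ω h2 h3 h4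
    rw [h2, h3, h4]
  exact (condExp_condExp_of_le hts hs).symm.trans
    ((condExp_congr_ae hsame).trans (condExp_condExp_of_le hts hs))

/-- Monotonicity and cash-subadditivity of `π_r^S`. -/
theorem IsPi.le_add {beta : Measure Ω → Ω → EReal} {X Y : Ω → Fin d → ℝ} {g h : Ω → EReal}
    (hg : IsPi F P d T r beta S X g) (hh : IsPi F P d T r beta S Y h) (c : Ω → ℝ)
    (hXY : ∀ Q ∈ QeS F P d T S, ∀ᵐ ω ∂P,
      EQcond F P Q r (fun ω' => dot (S T ω') (Y ω')) ω ≤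
        EQcond F P Q r (fun ω' => dot (S T ω') (X ω')) ω + c ω) :
    ∀ᵐ ω ∂P, g ω ≤ h ω + (c ω : ℝ) := by
  refine hg.2 _ ?_
  rintro _ ⟨Q, hQ, rfl⟩
  filter_upwards [hXY Q hQ, hh.1 _ ⟨Q, hQ, rfl⟩] with ω h1 h2
  refine le_trans ?_ (add_le_add_left h2 _)
  rw [sub_eq_add_neg, sub_eq_add_neg, add_assoc]
  refine add_le_add_right ?_ _
  rw [← EReal.coe_neg, ← EReal.coe_neg, ← EReal.coe_add, EReal.coe_le_coe_iff]
  linarith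

/-- Cash-additivity of `π_r^S`. -/
theorem IsPi.eq_add {beta : Measure Ω → Ω → EReal} {X Y : Ω → Fin d → ℝ} {g h : Ω → EReal}
    (hg : IsPi F P d T r beta S X g) (hh : IsPi F P d T r beta S Y h) (c : Ω → ℝ)
    (hXY : ∀ Q ∈ QeS F P d T S, ∀ᵐ ω ∂P,
      EQcond F P Q r (fun ω' => dot (S T ω') (Y ω')) ω =
        EQcond F P Q r (fun ω' => dot (S T ω') (X ω')) ω + c ω) :
    ∀ᵐ ω ∂P, g ω = h ω + (c ω : ℝ) := by
  have h1 := hg.le_add hh c fun Q hQ => (hXY Q hQ).mono fun ω h => h.le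
  have h2 := hh.le_add hg (fun ω => -c ω) fun Q hQ => (hXY Q hQ).mono fun ω h => by linarith
  filter_upwards [h1, h2] with ω h1 h2
  refine le_antisymm h1 ((add_le_add_left h2 _).trans ?_)
  rw [add_assoc, ← EReal.coe_add]
  simp

theorem IsPi.congr {beta : Measure Ω → Ω → EReal} {X Y : Ω → Fin d → ℝ} {g h : Ω → EReal}
    (hg : IsPi F P d T r beta S X g) (hh : IsPi F P d T r beta S Y h)
    (hXY : ∀ Q ∈ QeS F P d T S, EQcond F P Q r (fun ω' => dot (S T ω') (Y ω')) =ᵐ[P]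
        EQcond F P Q r (fun ω' => dot (S T ω') (X ω'))) :
    g =ᵐ[P] h := by
  filter_upwards [hg.eq_add hh (fun _ => 0) fun Q hQ => (hXY Q hQ).mono fun ω h => by simp [h]]
    with ω h
  simpa using h

/-- Versions of `π_r^S(X)` are `F_r`-measurable. -/
theorem IsPi.exists_measurable [IsProbabilityMeasure P] {beta : Measure Ω → Ω → EReal} {A : Set (Ω → Fin d → ℝ)}
    (hr : F r ≤ m0) (hbeta : ∀ Q ∈ QeS F P d T S, IsPenalty F P d T r A Q S (beta Q))
    {X : Ω → Fin d → ℝ} {g : Ω → EReal} (hg : IsPi F P d T r beta S X g) :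
    ∃ g', Measurable[F r] g' ∧ g =ᵐ[P] g' := by
  have hE : ∀ Q x, Measurable[F r] (EQcond F P Q r x) :=
    fun Q x => stronglyMeasurable_condExp.measurable
  refine IsEssSupSetE.exists_measurable hr hg ?_
  rintro _ ⟨Q, hQ, rfl⟩
  obtain ⟨b, hb, hbb⟩ := IsEssSupSetE.exists_measurable hr (hbeta Q hQ) (by
    rintro _ ⟨Z, -, rfl⟩
    exact ⟨_, (hE Q _).neg.coe_real_ereal, ae_eq_rfl⟩)
  refine ⟨fun ω => -b ω - ((EQcond F P Q r (fun ω' => dot (S T ω') (X ω')) ω : ℝ) : EReal),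
    ?_, hbb.mono fun ω h => by simp only [h]⟩
  simp only [sub_eq_add_neg]
  exact hb.neg.add (hE Q _).coe_real_ereal.neg

/-- `π_r^S(X)` lies in `L^∞(F_r)` as soon as `π_r^S(0)` does. -/
theorem IsPi.memLinfE [IsProbabilityMeasure P] {beta : Measure Ω → Ω → EReal} {A : Set (Ω → Fin d → ℝ)}
    (hr : F r ≤ m0) (hT : F T ≤ m0)
    (h1 : ∀ Q ∈ QeS F P d T S, P[xiBar F P Q r | F r] =ᵐ[P] fun _ => 1)
    (hbeta : ∀ Q ∈ QeS F P d T S, IsPenalty F P d T r A Q S (beta Q))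
    (hS : S T ∈ LinfD F d T) {X : Ω → Fin d → ℝ} (hX : X ∈ LinfD F d T) {g g₀ : Ω → EReal}
    (hg : IsPi F P d T r beta S X g) (hg₀ : IsPi F P d T r beta S (fun _ => 0) g₀)
    (h₀ : MemLinfE F P r g₀) : MemLinfE F P r g := by
  obtain ⟨x₀, ⟨-, C₀, hC₀⟩, hx₀⟩ := h₀
  obtain ⟨g', hg'm, hgg'⟩ := hg.exists_measurable hr hbeta
  have hSX := LinfD_dot hS hX
  have ⟨_, C, hC⟩ := hSX
  have hbound : ∀ Q ∈ QeS F P d T S, ∀ᵐ ω ∂P,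
      |EQcond F P Q r (fun ω' => dot (S T ω') (X ω')) ω| ≤ C := by
    intro Q hQ
    have hξ := integrable_of_condExp_eq_one (h1 Q hQ)
    filter_upwards [EQcond_mono hT hξ hSX (Linf_const C) fun ω => (abs_le.1 (hC ω)).2,
      EQcond_mono hT hξ (Linf_const (-C)) hSX fun ω => (abs_le.1 (hC ω)).1,
      EQcond_of_measurable hr (h1 Q hQ) (Linf_const C),
      EQcond_of_measurable hr (h1 Q hQ) (Linf_const (-C))] with ω a b c e
    rw [c] at a
    rw [e] at b
    exact abs_le.2 ⟨b, a⟩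
  have hzero : ∀ Q, EQcond F P Q r (fun ω' => dot (S T ω') (0 : Fin d → ℝ)) = 0 := by
    intro Q
    simp only [EQcond, dot, Pi.zero_apply, mul_zero, Finset.sum_const_zero]
    exact condExp_zero
  have hup := hg.le_add hg₀ (fun _ => C) fun Q hQ => (hbound Q hQ).mono fun ω h => by
    rw [hzero, Pi.zero_apply]
    linarith [(abs_le.1 h).1]
  have hlo := hg₀.le_add hg (fun _ => C) fun Q hQ => (hbound Q hQ).mono fun ω h => by
    rw [hzero, Pi.zero_apply]
    linarith [(abs_le.1 h).2]
  let B := C₀ + C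
  have hreal : ∀ᵐ ω ∂P, ∃ y : ℝ, g' ω = y ∧ |y| ≤ B := by
    filter_upwards [hup, hlo, hgg', hx₀] with ω hu hl hgω hx
    rw [hx, hgω] at hu hl
    have h5 := abs_le.1 (hC₀ ω)
    cases hv : g' ω with
    | bot =>
      rw [hv] at hl
      simp at hl
    | top =>
      rw [hv, ← EReal.coe_add] at hu
      exact absurd (top_le_iff.1 hu) (EReal.coe_ne_top _)
    | coe y =>
      rw [hv] at hu hl
      norm_cast at hu hl
      exact ⟨y, rfl, abs_le.2 ⟨by simp only [B]; linarith, by simp only [B]; linarith⟩⟩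
  refine ⟨fun ω => max (-|B|) (min |B| (g' ω).toReal), ⟨?_, |B|, fun ω => ?_⟩, ?_⟩
  · have : Measurable[F r] fun ω => (g' ω).toReal := hg'm.ereal_toReal
    exact measurable_const.max (measurable_const.min this)
  · exact abs_le.2 ⟨le_max_left _ _,
      max_le ((neg_nonpos.2 (abs_nonneg B)).trans (abs_nonneg B)) (min_le_left _ _)⟩
  · filter_upwards [hreal, hgg'] with ω ⟨y, hy, hyB⟩ hgω
    have hyB' := abs_le.1 (hyB.trans (le_abs_self B))
    rw [hgω, hy, EReal.toReal_coe, min_eq_right hyB'.2, max_eq_right hyB'.1]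

end Conditional

/-- Lemma 6.8.  Fix `S ∈ 𝒮*` and `0 ≤ t ≤ s ≤ T`.  Then:
(1) for `D ⊆ L^∞_d(F_s)` with `D + Γ_s(S_s) ⊆ D`: `X ∈ D + A_s^π` iff
`−π_s^S(X) ∈ S_s^⊤ D`; (2) `A_{t,s}^φ + A_s^φ = S_T^⊤ [A_{t,s}^π + A_s^π]`. -/
theorem statement15 [MeasurableSpace Ω] (F : ℕ → MeasurableSpace Ω) (P : Measure Ω)
    [IsProbabilityMeasure P] (d T : ℕ) (K : ℕ → Ω → Set (Fin d → ℝ))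
    (hFil : FiltrationOK F P T) (hK : ConesOK K) (hKbar : FrictionAssumption P T K)
    (rho : ℕ → (Ω → Fin d → ℝ) → Ω → ℝ)
    (hrho : ∀ r ≤ T, ScalarRM F P d T r (rho r) ∧ KCompat F P d T K r (rho r) ∧
      Fatou F P d T (rho r) ∧ Relevant P d (rho r))
    (S : ℕ → Ω → Fin d → ℝ) (hS : memS F d T K S)
    (beta : ℕ → Measure Ω → Ω → EReal)
    (hbeta : ∀ r ≤ T, ∀ Q ∈ QeS F P d T S,
      IsPenalty F P d T r (Acc F P d T (rho r)) Q S (beta r Q))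
    (pi : ℕ → (Ω → Fin d → ℝ) → Ω → EReal)
    (hpi : ∀ r ≤ T, ∀ X ∈ LinfD F d T, IsPi F P d T r (beta r) S X (pi r X))
    -- `S ∈ 𝒮*`:
    (hSstar : ∀ r ≤ T, MemLinfE F P r (pi r fun _ _ => 0))
    (t s : ℕ) (hts : t ≤ s) (hsT : s ≤ T) :
    -- (1):
    (∀ D : Set (Ω → Fin d → ℝ), D ⊆ LinfD F d s →
      (∀ u ∈ D, ∀ k ∈ Gamma F P d S s, (fun ω => u ω + k ω) ∈ D) →
      ∀ X ∈ LinfD F d T,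
        ((∃ u ∈ D, ∃ v ∈ Api F P d T pi s, X =ᵐ[P] fun ω => u ω + v ω) ↔
          ∃ u ∈ D,
            pi s X =ᵐ[P] fun ω => ((-(dot (S s ω) (u ω)) : ℝ) : EReal))) ∧
    -- (2):
    (∀ Z : Ω → ℝ,
      ((∃ z₁, z₁ ∈ Aphi F P d T pi t ∧ z₁ ∈ Linf F s ∧
          ∃ z₂ ∈ Aphi F P d T pi s, Z =ᵐ[P] fun ω => z₁ ω + z₂ ω) ↔
        (∃ X₁, X₁ ∈ Api F P d T pi t ∧ X₁ ∈ LinfD F d s ∧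
          ∃ X₂ ∈ Api F P d T pi s,
            Z =ᵐ[P] fun ω => dot (S T ω) (X₁ ω + X₂ ω)))) := by
  obtain ⟨hmonoF, hle, -, -⟩ := hFil
  have hFsT : F s ≤ F T := hmonoF s T hsT
  have hFts : F t ≤ F s := hmonoF t s hts
  have htT : t ≤ T := hts.trans hsT
  have hd : 0 < d := by
    rcases Nat.eq_zero_or_pos d with rfl | hd
    · exfalso
      have hc := (hrho T le_rfl).1.cash (fun _ => 0) (LinfD_of_apply fun i => i.elim0)
        (fun _ => 1) (Linf_const 1)
      have hfun : (fun ω : Ω => (0 : Fin 0 → ℝ) + (1 : ℝ) • e1 0) = fun _ => 0 :=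
        funext fun ω => Subsingleton.elim _ _
      rw [hfun] at hc
      obtain ⟨ω, hω⟩ := hc.exists
      linarith
    · exact hd
  have hST : S T ∈ LinfD F d T := (hS T le_rfl).1
  have hST1 := (hS T le_rfl).2.2.1
  have hSs := (hS s hsT).1
  have hSs1 := (hS s hsT).2.2.1
  have hξ : ∀ r ≤ T, ∀ Q ∈ QeS F P d T S, P[xiBar F P Q r | F r] =ᵐ[P] fun _ => 1 :=
    fun r hr Q hQ => condExp_xiBar hd hr (hS r hr).2.2.1 hST1 hQ
  have hξi : ∀ r ≤ T, ∀ Q ∈ QeS F P d T S, Integrable (xiBar F P Q r) P :=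
    fun r hr Q hQ => integrable_of_condExp_eq_one (hξ r hr Q hQ)
  have hdotT : ∀ {X : Ω → Fin d → ℝ}, X ∈ LinfD F d T →
      (fun ω => dot (S T ω) (X ω)) ∈ Linf F T := fun hX => LinfD_dot hST hX
  have hcash : ∀ X ∈ LinfD F d T, ∀ u ∈ LinfD F d s, ∀ v ∈ LinfD F d T,
      (X =ᵐ[P] fun ω => u ω + v ω) →
      ∀ᵐ ω ∂P, pi s v ω = pi s X ω + (dot (S s ω) (u ω) : ℝ) := by
    intro X hX u hu v hv hXuv
    refine (hpi s hsT v hv).eq_add (hpi s hsT X hX) _ fun Q hQ => ?_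
    have h1 : (fun ω => dot (S T ω) (X ω)) =ᵐ[P]
        fun ω => dot (S T ω) (u ω) + dot (S T ω) (v ω) := by
      filter_upwards [hXuv] with ω h
      rw [h, dot_add]
    filter_upwards [EQcond_congr (F := F) (Q := Q) (r := s) h1,
      EQcond_add (hle T) (hξi s hsT Q hQ) (hdotT (LinfD_mono hFsT hu)) (hdotT hv),
      EQcond_dot (hle s) (hle T) hsT (hξi s hsT Q hQ) hQ hST hu] with ω a b c
    rw [a, b, c, add_comm]
  refine ⟨fun D hD hDΓ X hX => ⟨?_, ?_⟩, fun Z => ⟨?_, ?_⟩⟩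
  · rintro ⟨u, hu, v, ⟨hv, hv0⟩, hXuv⟩
    obtain ⟨p, hp, hpv⟩ := (hpi s hsT v hv).memLinfE (hle s) (hle T) (hξ s hsT)
      (hbeta s hsT) hST hv (hpi s hsT _ (LinfD_of_apply fun i => Linf_const 0)) (hSstar s hsT)
    refine ⟨fun ω => u ω + (-p ω) • e1 d, hDΓ u hu _ ⟨LinfD_smul_e1 (Linf_neg hp), ?_⟩, ?_⟩
    · filter_upwards [hv0, hpv] with ω h1 h2
      rw [h2] at h1
      rw [dot_smul_e1 hd (hSs1 ω)]
      have : p ω ≤ 0 := by exact_mod_cast h1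
      linarith
    · filter_upwards [hcash X hX u (hD hu) v hv hXuv, hpv] with ω h1 h2
      rw [dot_add, dot_smul_e1 hd (hSs1 ω)]
      rw [h2] at h1
      have h3 : pi s X ω = (p ω : EReal) - (dot (S s ω) (u ω) : ℝ) := by
        rw [h1, EReal.add_sub_cancel_right]
      rw [h3, ← EReal.coe_sub]
      congr 1
      ring
  · rintro ⟨u, hu, hXu⟩
    have hv : (fun ω => X ω - u ω) ∈ LinfD F d T := LinfD_sub hX (LinfD_mono hFsT (hD hu))
    have hXuv : X =ᵐ[P] fun ω => u ω + (X ω - u ω) := ae_of_all _ fun ω => by simp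
    refine ⟨u, hu, _, ⟨hv, ?_⟩, hXuv⟩
    filter_upwards [hcash X hX u (hD hu) _ hv hXuv, hXu] with ω h1 h2
    rw [h1, h2, ← EReal.coe_add]
    simp
  · rintro ⟨z₁, ⟨hz₁T, hz₁⟩, hz₁s, z₂, ⟨hz₂T, hz₂⟩, hZ⟩
    refine ⟨fun ω => z₁ ω • e1 d, ⟨LinfD_smul_e1 hz₁T, hz₁⟩, LinfD_smul_e1 hz₁s,
      fun ω => z₂ ω • e1 d, ⟨LinfD_smul_e1 hz₂T, hz₂⟩, ?_⟩
    filter_upwards [hZ] with ω h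
    rw [h, dot_add, dot_smul_e1 hd (hST1 ω), dot_smul_e1 hd (hST1 ω)]
  · rintro ⟨X₁, ⟨hX₁T, hX₁⟩, hX₁s, X₂, ⟨hX₂T, hX₂⟩, hZ⟩
    have hz₁ : (fun ω => dot (S s ω) (X₁ ω)) ∈ Linf F s := LinfD_dot hSs hX₁s
    have hz₁T := Linf_mono hFsT hz₁
    have hz₂ : (fun ω => (dot (S T ω) (X₁ ω) + dot (S T ω) (X₂ ω)) + -dot (S s ω) (X₁ ω)) ∈
        Linf F T := Linf_add (Linf_add (hdotT hX₁T) (hdotT hX₂T)) (Linf_neg hz₁T)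
    refine ⟨_, ⟨hz₁T, ?_⟩, hz₁, _, ⟨hz₂, ?_⟩, ?_⟩
    · have : pi t (fun ω => dot (S s ω) (X₁ ω) • e1 d) =ᵐ[P] pi t X₁ := by
        refine (hpi t htT _ (LinfD_smul_e1 hz₁T)).congr (hpi t htT _ hX₁T) fun Q hQ => ?_
        simp only [dot_smul_e1 hd (hST1 _)]
        exact (EQcond_tower hFts (hle s) (hle T) (hξi t htT Q hQ) (hξ s hsT Q hQ) hQ
          (hdotT hX₁T) hz₁
          (EQcond_dot (hle s) (hle T) hsT (hξi s hsT Q hQ) hQ hST hX₁s)).symm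
      filter_upwards [this, hX₁] with ω h1 h2
      rwa [h1]
    · have : pi s (fun ω => ((dot (S T ω) (X₁ ω) + dot (S T ω) (X₂ ω)) +
          -dot (S s ω) (X₁ ω)) • e1 d) =ᵐ[P] pi s X₂ := by
        refine (hpi s hsT _ (LinfD_smul_e1 hz₂)).congr (hpi s hsT _ hX₂T) fun Q hQ => ?_
        simp only [dot_smul_e1 hd (hST1 _)]
        have hi := hξi s hsT Q hQ
        filter_upwards [EQcond_add (hle T) hi (Linf_add (hdotT hX₁T) (hdotT hX₂T)) (Linf_neg hz₁T),
          EQcond_add (hle T) hi (hdotT hX₁T) (hdotT hX₂T),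
          EQcond_of_measurable (hle s) (hξ s hsT Q hQ) (Linf_neg hz₁),
          EQcond_dot (hle s) (hle T) hsT hi hQ hST hX₁s] with ω a b c e
        rw [a, b, c, e]
        ring
      filter_upwards [this, hX₂] with ω h1 h2
      rwa [h1]
    · filter_upwards [hZ] with ω h
      rw [h, dot_add]
      ring

end RiskPaper
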